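/- Let B be an abundant acyclic quiver on n vertices. Then the framed quiver [B | I_n] and the coframed quiver [B | -I_n] are strictly sign-coherent: after every sequence of mutations at mutable vertices, every c-vector is nonzero with all entries ≥ 0 or all entries ≤ 0 (equivalently, every mutable vertex is red or green). -/

import Mathlib

open Matrix

section QuiverDefs

variable {V W : Type*}

/-- Mutation of an exchange matrix at the vertex `k`. -/
def mutB [DecidableEq V] (B : Matrix V V ℤ) (k : V) : Matrix V V ℤ :=
  Matrix.of fun i j =>
    if i = k ∨ j = k then -B i j else B i j + (B i k).sign * max (B i k * B k j) 0

/-- Mutation of the `C`-matrix of an extended exchange matrix `[B | C]` at the vertex `k`. -/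
def mutC [DecidableEq V] (B : Matrix V V ℤ) (C : Matrix V W ℤ) (k : V) : Matrix V W ℤ :=
  Matrix.of fun i j =>
    if i = k then -C i j else C i j + (B i k).sign * max (B i k * C k j) 0

/-- One mutation step on an extended exchange matrix `[B | C]`, regarded as a pair `(B, C)`. -/
def mutPair [DecidableEq V] (P : Matrix V V ℤ × Matrix V W ℤ) (k : V) :
    Matrix V V ℤ × Matrix V W ℤ :=
  (mutB P.1 k, mutC P.1 P.2 k)

/-- Iterated mutation of an extended exchange matrix along a list of mutable vertices. -/
def mutSeqPair [DecidableEq V] (P : Matrix V V ℤ × Matrix V W ℤ) (w : List V) :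
    Matrix V V ℤ × Matrix V W ℤ :=
  w.foldl mutPair P

/-- Iterated mutation of an exchange matrix along a list of vertices. -/
def mutSeqB [DecidableEq V] (B : Matrix V V ℤ) (w : List V) : Matrix V V ℤ :=
  w.foldl mutB B

/-- A quiver is abundant if there are at least two arrows between any two distinct vertices. -/
def QAbundant (B : Matrix V V ℤ) : Prop := ∀ i j, i ≠ j → 2 ≤ |B i j|

/-- There is a directed cycle of the quiver `B` all of whose vertices lie in `S`. -/
def HasCycleIn (B : Matrix V V ℤ) (S : Set V) : Prop :=
  ∃ (x : V) (l : List V), x ∈ S ∧ (∀ y ∈ l, y ∈ S) ∧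
    List.Chain (fun i j => 0 < B i j) x (l ++ [x])

/-- A quiver is acyclic if it has no directed cycle. -/
def QAcyclic (B : Matrix V V ℤ) : Prop := ¬ HasCycleIn B Set.univ

/-- The vertex `x` is a source: all arrows at `x` point away from `x`. -/
def QSource (B : Matrix V V ℤ) (x : V) : Prop := ∀ j, 0 ≤ B x j

/-- The vertex `x` is a sink: all arrows at `x` point into `x`. -/
def QSink (B : Matrix V V ℤ) (x : V) : Prop := ∀ j, B x j ≤ 0

/-- `B` is a fork with point of return `r`: it is abundant, not acyclic, the full subquiver
obtained by deleting `r` is acyclic, and for all `i` with `i → r` and `j` with `r → j` one has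
`b_{ji} > b_{ir}` and `b_{ji} > b_{rj}`. -/
def QFork (B : Matrix V V ℤ) (r : V) : Prop :=
  QAbundant B ∧ ¬ QAcyclic B ∧ ¬ HasCycleIn B {x | x ≠ r} ∧
    ∀ i j, 0 < B i r → 0 < B r j → B i r < B j i ∧ B r j < B j i

/-- The mutable vertex `i` is green: its `c`-vector is nonzero with all entries `≥ 0`. -/
def QGreen (C : Matrix V W ℤ) (i : V) : Prop := (∀ j, 0 ≤ C i j) ∧ C i ≠ 0

/-- The mutable vertex `i` is red: its `c`-vector is nonzero with all entries `≤ 0`. -/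
def QRed (C : Matrix V W ℤ) (i : V) : Prop := (∀ j, C i j ≤ 0) ∧ C i ≠ 0

/-- The mutable vertex `i` is blue: its `c`-vector is zero. -/
def QBlue (C : Matrix V W ℤ) (i : V) : Prop := C i = 0

/-- `i` has the same color (red/green/blue) with respect to `C` and to `C'`. -/
def SameColorQ (C C' : Matrix V W ℤ) (i : V) : Prop :=
  (QRed C i ↔ QRed C' i) ∧ (QGreen C i ↔ QGreen C' i) ∧ (QBlue C i ↔ QBlue C' i)

/-- The `c`-vectors of `i` and `j` have the same sign (`sgn(c_i) = sgn(c_j)`). -/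
def SameSignQ (C : Matrix V W ℤ) (i j : V) : Prop :=
  (QGreen C i ∧ QGreen C j) ∨ (QRed C i ∧ QRed C j)

/-- The `c`-vectors of `i` and `j` have opposite signs (`sgn(c_i) = -sgn(c_j)`). -/
def OppSignQ (C : Matrix V W ℤ) (i j : V) : Prop :=
  (QGreen C i ∧ QRed C j) ∨ (QRed C i ∧ QGreen C j)

/-- An ice quiver is uniformly sign-coherent if after every mutation sequence every mutable
vertex is red, green, or blue, and not every mutable vertex of the initial quiver is blue. -/
def USC [DecidableEq V] (P : Matrix V V ℤ × Matrix V W ℤ) : Prop :=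
  (∀ (w : List V) (i : V),
      QRed (mutSeqPair P w).2 i ∨ QGreen (mutSeqPair P w).2 i ∨ QBlue (mutSeqPair P w).2 i) ∧
    ¬ ∀ i, QBlue P.2 i

/-- An ice quiver is strictly sign-coherent if after every mutation sequence every mutable
vertex is red or green. -/
def SSC [DecidableEq V] (P : Matrix V V ℤ × Matrix V W ℤ) : Prop :=
  ∀ (w : List V) (i : V), QRed (mutSeqPair P w).2 i ∨ QGreen (mutSeqPair P w).2 i

/-- The four sign conditions at the distinguished vertex `r`:
(1) every mutable vertex is red or green;
(2) if every entry of `b_{rj}·c_j` is `≥ 0` for some `j ≠ r`, then `sgn(c_j) = sgn(c_r)` or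
    `sgn(c_j)·c_j ≥ sgn(c_r)·c_r` entrywise (i.e. `|c_r| ≤ |c_j|` entrywise);
(3) if every entry of `b_{rj}·c_j` is `≤ 0` for some `j ≠ r`, then `sgn(c_j) = -sgn(c_r)`;
(4) if every entry of `b_{ij}·c_j` is `≥ 0` for distinct `i, j` both `≠ r`,
    then `sgn(c_i) = sgn(c_j)`. -/
def FourConds (Bw : Matrix V V ℤ) (Cw : Matrix V W ℤ) (r : V) : Prop :=
  (∀ i, QRed Cw i ∨ QGreen Cw i) ∧
  (∀ j, j ≠ r → (∀ t, 0 ≤ Bw r j * Cw j t) →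
    (SameSignQ Cw j r ∨ ∀ t, |Cw r t| ≤ |Cw j t|)) ∧
  (∀ j, j ≠ r → (∀ t, Bw r j * Cw j t ≤ 0) → OppSignQ Cw j r) ∧
  (∀ i j, i ≠ j → i ≠ r → j ≠ r → (∀ t, 0 ≤ Bw i j * Cw j t) → SameSignQ Cw i j)

end QuiverDefs

section Helpers

variable {V W : Type*}

/-- Skew-symmetric, abundant. -/
structure SkAb (B : Matrix V V ℤ) : Prop where
  sk : ∀ i j, B j i = -B i j
  ab : ∀ i j, i ≠ j → 2 ≤ B i j ∨ B i j ≤ -2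

/-- A "quasi-fork" with point of return `r`. -/
structure QF (B : Matrix V V ℤ) (r : V) : Prop extends SkAb B where
  tr : ∀ i j k, i ≠ r → j ≠ r → k ≠ r → 0 < B i j → 0 < B j k → 0 < B i k
  fk : ∀ i j, 0 < B i r → 0 < B r j → B i r < B j i ∧ B r j < B j i

/-- The sign conditions, `G` being the set of green vertices. -/
structure SC (B : Matrix V V ℤ) (C : Matrix V W ℤ) (r : V) (G : V → Prop) : Prop where
  gp : ∀ i, G i → ∀ t, 0 ≤ C i t
  gn : ∀ i, ¬ G i → ∀ t, C i t ≤ 0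
  nz : ∀ i, ∃ t, C i t ≠ 0
  c2a : ∀ j, G j → ¬ G r → 0 < B r j → ∀ t, -C r t ≤ C j t
  c2b : ∀ j, ¬ G j → G r → B r j < 0 → ∀ t, C r t ≤ -C j t
  c3a : ∀ j, j ≠ r → G j → G r → 0 < B r j
  c3b : ∀ j, j ≠ r → ¬ G j → ¬ G r → B r j < 0
  c4 : ∀ i j, i ≠ r → j ≠ r → G i → ¬ G j → 0 < B i j

theorem QF.neg {B : Matrix V V ℤ} {r : V} (h : QF B r) : QF (-B) r where
  sk i j := by simp [h.sk i j]
  ab i j hij := by have := h.ab i j hij; simp only [Matrix.neg_apply]; omega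
  tr i j k hi hj hk h1 h2 := by
    simp only [Matrix.neg_apply] at *
    have := h.tr k j i hk hj hi (by rw [h.sk j k]; exact h2) (by rw [h.sk i j]; exact h1)
    rw [h.sk i k] at this; exact this
  fk i j h1 h2 := by
    simp only [Matrix.neg_apply] at *
    have := h.fk j i (by rw [h.sk r j]; exact h2) (by rw [h.sk i r]; exact h1)
    rw [h.sk r j, h.sk i r] at this
    rw [h.sk i j]
    omega

theorem SC.neg {B : Matrix V V ℤ} {C : Matrix V W ℤ} {r : V} {G : V → Prop}
    (h : SC B C r G) (hB : QF B r) : SC (-B) (-C) r (fun i => ¬ G i) where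
  gp i hi t := by have := h.gn i hi t; simp only [Matrix.neg_apply]; omega
  gn i hi t := by have := h.gp i (not_not.1 hi) t; simp only [Matrix.neg_apply]; omega
  nz i := by obtain ⟨t, ht⟩ := h.nz i; exact ⟨t, by simpa using ht⟩
  c2a j h1 h2 h3 t := by
    simp only [Matrix.neg_apply] at *
    have := h.c2b j h1 (not_not.1 h2) (by omega) t; omega
  c2b j h1 h2 h3 t := by
    simp only [Matrix.neg_apply] at *
    have := h.c2a j (not_not.1 h1) h2 (by omega) t; omega
  c3a j hj h1 h2 := by
    have := h.c3b j hj h1 h2; simp only [Matrix.neg_apply]; omega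
  c3b j hj h1 h2 := by
    have := h.c3a j hj (not_not.1 h1) (not_not.1 h2); simp only [Matrix.neg_apply]; omega
  c4 i j hi hj h1 h2 := by
    have := h.c4 j i hj hi (not_not.1 h2) h1
    rw [hB.sk i j] at this; simpa using this

variable [DecidableEq V]

theorem mutB_of_left (B : Matrix V V ℤ) (k j : V) : mutB B k k j = -B k j := by simp [mutB]
theorem mutB_of_right (B : Matrix V V ℤ) (k i : V) : mutB B k i k = -B i k := by simp [mutB]
theorem mutC_self (B : Matrix V V ℤ) (C : Matrix V W ℤ) (k : V) (t : W) :
    mutC B C k k t = -C k t := by simp [mutC]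

theorem max_aux_pos {a b : ℤ} (ha : 0 < a) (hb : 0 ≤ b) : a.sign * max (a * b) 0 = a * b := by
  rw [Int.sign_eq_one_of_pos ha, max_eq_left (by positivity), one_mul]
theorem max_aux_zero {a b : ℤ} (ha : 0 ≤ a) (hb : b ≤ 0) : a.sign * max (a * b) 0 = 0 := by
  rw [max_eq_right (mul_nonpos_of_nonneg_of_nonpos ha hb), mul_zero]
theorem max_aux_zero' {a b : ℤ} (ha : a ≤ 0) (hb : 0 ≤ b) : a.sign * max (a * b) 0 = 0 := by
  rw [max_eq_right (mul_nonpos_of_nonpos_of_nonneg ha hb), mul_zero]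
theorem max_aux_neg {a b : ℤ} (ha : a < 0) (hb : b ≤ 0) : a.sign * max (a * b) 0 = - (a * b) := by
  rw [Int.sign_eq_neg_one_of_neg ha, max_eq_left (mul_nonneg_of_nonpos_of_nonpos ha.le hb)]; ring

theorem mutB_pp {B : Matrix V V ℤ} {k i j : V} (hi : i ≠ k) (hj : j ≠ k) (h1 : 0 < B i k)
    (h2 : 0 < B k j) : mutB B k i j = B i j + B i k * B k j := by
  simp only [mutB, Matrix.of_apply, hi, hj, or_self, if_false]; rw [max_aux_pos h1 h2.le]
theorem mutB_nn {B : Matrix V V ℤ} {k i j : V} (hi : i ≠ k) (hj : j ≠ k) (h1 : B i k < 0)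
    (h2 : B k j < 0) : mutB B k i j = B i j - B i k * B k j := by
  simp only [mutB, Matrix.of_apply, hi, hj, or_self, if_false]; rw [max_aux_neg h1 h2.le]; ring
theorem mutB_pn {B : Matrix V V ℤ} {k i j : V} (hi : i ≠ k) (hj : j ≠ k) (h1 : 0 < B i k)
    (h2 : B k j < 0) : mutB B k i j = B i j := by
  simp only [mutB, Matrix.of_apply, hi, hj, or_self, if_false]; rw [max_aux_zero h1.le h2.le, add_zero]
theorem mutB_np {B : Matrix V V ℤ} {k i j : V} (hi : i ≠ k) (hj : j ≠ k) (h1 : B i k < 0)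
    (h2 : 0 < B k j) : mutB B k i j = B i j := by
  simp only [mutB, Matrix.of_apply, hi, hj, or_self, if_false]; rw [max_aux_zero' h1.le h2.le, add_zero]

theorem mutC_p {B : Matrix V V ℤ} {C : Matrix V W ℤ} {k i : V} {t : W} (hi : i ≠ k) (h1 : 0 < B i k)
    (h2 : 0 ≤ C k t) : mutC B C k i t = C i t + B i k * C k t := by
  simp only [mutC, Matrix.of_apply, hi, if_false]; rw [max_aux_pos h1 h2]
theorem mutC_n {B : Matrix V V ℤ} {C : Matrix V W ℤ} {k i : V} {t : W} (hi : i ≠ k) (h1 : B i k < 0)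
    (h2 : 0 ≤ C k t) : mutC B C k i t = C i t := by
  simp only [mutC, Matrix.of_apply, hi, if_false]; rw [max_aux_zero' h1.le h2, add_zero]

theorem mutB_neg (B : Matrix V V ℤ) (k : V) : mutB (-B) k = -mutB B k := by
  ext i j
  simp only [mutB, Matrix.of_apply, Matrix.neg_apply, Int.sign_neg, neg_mul_neg]
  split_ifs <;> ring
theorem mutC_neg (B : Matrix V V ℤ) (C : Matrix V W ℤ) (k : V) :
    mutC (-B) (-C) k = -mutC B C k := by
  ext i j
  simp only [mutC, Matrix.of_apply, Matrix.neg_apply, Int.sign_neg, neg_mul_neg]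
  split_ifs <;> ring

theorem mutPair_invol (P : Matrix V V ℤ × Matrix V W ℤ) (k : V) :
    mutPair (mutPair P k) k = P := by
  obtain ⟨B, C⟩ := P
  refine Prod.ext ?_ ?_
  · ext i j
    by_cases hi : i = k
    · subst hi; simp [mutPair, mutB]
    by_cases hj : j = k
    · subst hj; simp [mutPair, mutB]
    simp [mutPair, mutB, hi, hj]
  · ext i j
    by_cases hi : i = k
    · subst hi; simp [mutPair, mutC]
    simp [mutPair, mutC, mutB, hi]

/-- Mutation of a skew-symmetric abundant quiver at `k` is a quasi-fork with point of return `k`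
as soon as the following local conditions hold. -/
theorem QF_of_local {B : Matrix V V ℤ} {k : V} (h : SkAb B)
    (hg : ∀ i j, 0 < B i k → 0 < B k j →
      B i k < B i j + B i k * B k j ∧ B k j < B i j + B i k * B k j)
    (hP : ∀ i j l, 0 < B i k → 0 < B j k → 0 < B l k → 0 < B i j → 0 < B j l → 0 < B i l)
    (hS : ∀ i j l, 0 < B k i → 0 < B k j → 0 < B k l → 0 < B i j → 0 < B j l → 0 < B i l) :
    QF (mutB B k) k := by
  have sk := h.sk
  have kk : B k k = 0 := by have := sk k k; omega
  have dich : ∀ i, i ≠ k → (0 < B i k ∧ B k i < 0) ∨ (B i k < 0 ∧ 0 < B k i) := by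
    intro i hi
    have := h.ab i k hi; have := sk i k; omega
  have ps : ∀ i j, 0 < B i k → 0 < B k j → B i k < mutB B k i j ∧ B k j < mutB B k i j := by
    intro i j hi hj
    rw [mutB_pp (by rintro rfl; omega) (by rintro rfl; omega) hi hj]
    exact hg i j hi hj
  have sk' : ∀ i j, mutB B k j i = - mutB B k i j := by
    intro i j
    by_cases hi : i = k
    · subst hi; rw [mutB_of_left, mutB_of_right, sk i j]
    by_cases hj : j = k
    · subst hj; rw [mutB_of_left, mutB_of_right, sk i j]
    rcases dich i hi with ⟨a, b⟩ | ⟨a, b⟩ <;> rcases dich j hj with ⟨c, d⟩ | ⟨c, d⟩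
    · rw [mutB_pn hi hj a d, mutB_pn hj hi c b, sk i j]
    · rw [mutB_pp hi hj a d, mutB_nn hj hi c b, sk i j, sk k j, sk i k]; ring
    · rw [mutB_nn hi hj a d, mutB_pp hj hi c b, sk i j, sk k j, sk i k]; ring
    · rw [mutB_np hi hj a d, mutB_np hj hi c b, sk i j]
  refine ⟨⟨sk', ?_⟩, ?_, ?_⟩
  · intro i j hij
    by_cases hi : i = k
    · subst hi; rw [mutB_of_left]; have := h.ab i j hij; omega
    by_cases hj : j = k
    · subst hj; rw [mutB_of_right]; have := h.ab i j hij; omega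
    have := h.ab i j hij
    rcases dich i hi with ⟨a, b⟩ | ⟨a, b⟩ <;> rcases dich j hj with ⟨c, d⟩ | ⟨c, d⟩
    · rwa [mutB_pn hi hj a d]
    · have := ps i j a d; omega
    · have := ps j i c b; rw [sk'] at this; omega
    · rwa [mutB_np hi hj a d]
  · intro i j l hi hj hl h1 h2
    rcases dich i hi with ⟨a, b⟩ | ⟨a, b⟩ <;> rcases dich l hl with ⟨e, f⟩ | ⟨e, f⟩
    · rcases dich j hj with ⟨c, d⟩ | ⟨c, d⟩
      · rw [mutB_pn hi hj a d] at h1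
        rw [mutB_pn hj hl c f] at h2
        rw [mutB_pn hi hl a f]
        exact hP i j l a c e h1 h2
      · have := ps l j e d; rw [sk'] at this; omega
    · have := ps i l a f; omega
    · rcases dich j hj with ⟨c, d⟩ | ⟨c, d⟩
      · have := ps j i c b; rw [sk'] at this; omega
      · have := ps l j e d; rw [sk'] at this; omega
    · rcases dich j hj with ⟨c, d⟩ | ⟨c, d⟩
      · have := ps j i c b; rw [sk'] at this; omega
      · rw [mutB_np hi hj a d] at h1
        rw [mutB_np hj hl c f] at h2
        rw [mutB_np hi hl a f]
        exact hS i j l b d f h1 h2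
  · intro i j h1 h2
    rw [mutB_of_right] at *
    rw [mutB_of_left] at *
    have := ps j i (by have := sk k j; omega) (by have := sk i k; omega)
    have := sk k j
    have := sk i k
    omega

/-- Local inequality for the growth of the arrows. -/
theorem QF.grow {B : Matrix V V ℤ} {r k : V} (h : QF B r) (hk : k ≠ r) (i j : V)
    (hi : 0 < B i k) (hj : 0 < B k j) :
    B i k < B i j + B i k * B k j ∧ B k j < B i j + B i k * B k j := by
  have sk := h.sk
  have kk : B k k = 0 := by have := sk k k; omega
  have hik : i ≠ k := by rintro rfl; omega
  have hjk : j ≠ k := by rintro rfl; omega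
  have hij : i ≠ j := by rintro rfl; have := sk i k; omega
  have a1 : 2 ≤ B i k := by have := h.ab i k hik; omega
  have a2 : 2 ≤ B k j := by have := h.ab k j hjk.symm; omega
  by_cases hpos : 0 < B i j
  · constructor <;> nlinarith
  have hneg : 0 < B j i := by have := h.ab i j hij; have := sk i j; omega
  have hs := sk i j
  by_cases hir : i = r
  · subst hir
    have := h.fk j k hneg hi
    constructor <;> nlinarith
  by_cases hjr : j = r
  · subst hjr
    have := h.fk k i hj hneg
    constructor <;> nlinarith
  have := h.tr i k j hir hk hjr hi hj
  omega

theorem QF.step {B : Matrix V V ℤ} {r k : V} (h : QF B r) (hk : k ≠ r) : QF (mutB B k) k := by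
  have sk := h.sk
  have dd : ∀ i, B i i = 0 := fun i => by have := sk i i; omega
  refine QF_of_local h.toSkAb (h.grow hk) ?_ ?_
  · intro i j l hi hj hl h1 h2
    have hil : i ≠ l := by rintro rfl; have := sk i j; omega
    by_contra hcon
    have h3 : 0 < B l i := by have := h.ab i l hil; have := sk i l; omega
    have s1 := sk i k
    have s2 := sk j k
    have s3 := sk l k
    by_cases e1 : i = r
    · subst e1; have := h.fk l k h3 hi; omega
    by_cases e2 : j = r
    · subst e2; have := h.fk i k h1 hj; omega
    by_cases e3 : l = r
    · subst e3; have := h.fk j k h2 hl; omega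
    exact hcon (h.tr i j l e1 e2 e3 h1 h2)
  · intro i j l hi hj hl h1 h2
    have hil : i ≠ l := by rintro rfl; have := sk i j; omega
    by_contra hcon
    have h3 : 0 < B l i := by have := h.ab i l hil; have := sk i l; omega
    have s1 := sk i k
    have s2 := sk j k
    have s3 := sk l k
    by_cases e1 : i = r
    · subst e1; have := h.fk k j hi h1; omega
    by_cases e2 : j = r
    · subst e2; have := h.fk k l hj h2; omega
    by_cases e3 : l = r
    · subst e3; have := h.fk k i hl h3; omega
    exact hcon (h.tr i j l e1 e2 e3 h1 h2)

/-- Step for the sign conditions at a green vertex. -/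
theorem SC.step_green {B : Matrix V V ℤ} {C : Matrix V W ℤ} {r k : V} {G : V → Prop}
    (h : SC B C r G) (hB : QF B r) (hk : k ≠ r) (hG : G k) :
    SC (mutB B k) (mutC B C k) k (fun i => i ≠ k ∧ (0 < B i k ∨ G i)) := by
  have sk := hB.sk
  have kk : B k k = 0 := by have := sk k k; omega
  have ck := h.gp k hG
  have dich : ∀ i, i ≠ k → (2 ≤ B i k ∧ B k i < 0) ∨ (B i k < 0 ∧ 0 < B k i) := by
    intro i hi
    have := hB.ab i k hi; have := sk i k; omega
  have hP : ∀ i, 0 < B i k → ∀ t, C k t ≤ mutC B C k i t := by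
    intro i hi t
    have hik : i ≠ k := by rintro rfl; omega
    have a1 : 2 ≤ B i k := by have := dich i hik; omega
    rw [mutC_p hik hi (ck t)]
    have c0 := ck t
    by_cases hGi : G i
    · have := h.gp i hGi t; nlinarith
    · by_cases hir : i = r
      · subst hir
        have := h.c2a k hG hGi hi t; nlinarith
      · have := h.c4 k i hk hir hG hGi; have := sk i k; omega
  have hT : ∀ i, i ≠ k → ¬ 0 < B i k → ∀ t, mutC B C k i t = C i t := by
    intro i hik hi t
    exact mutC_n hik (by have := dich i hik; omega) (ck t)
  constructor
  · rintro i ⟨hik, hi⟩ t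
    by_cases hp : 0 < B i k
    · exact (ck t).trans (hP i hp t)
    · rw [hT i hik hp]; exact h.gp i (hi.resolve_left hp) t
  · intro i hi t
    by_cases hik : i = k
    · subst hik; rw [mutC_self]; have := ck t; omega
    · push Not at hi
      have := hi hik
      rw [hT i hik (by omega)]; exact h.gn i this.2 t
  · intro i
    by_cases hik : i = k
    · subst hik
      obtain ⟨t, ht⟩ := h.nz i
      exact ⟨t, by rw [mutC_self]; omega⟩
    by_cases hp : 0 < B i k
    · obtain ⟨t, ht⟩ := h.nz k
      exact ⟨t, by have := hP i hp t; have := ck t; omega⟩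
    · obtain ⟨t, ht⟩ := h.nz i
      exact ⟨t, by rwa [hT i hik hp]⟩
  · rintro j ⟨hjk, hj⟩ - hb t
    rw [mutB_of_left] at hb
    rw [mutC_self, neg_neg]
    exact hP j (by have := sk k j; omega) t
  · rintro j - h2
    exact absurd rfl h2.1
  · rintro j - - h2
    exact absurd rfl h2.1
  · intro j hjk h1 _
    rw [mutB_of_left]
    push Not at h1
    have := h1 hjk
    have := dich j hjk
    omega
  · rintro i j hik hjk ⟨-, hi⟩ hj
    push Not at hj
    obtain ⟨hj1, hj2⟩ := hj hjk
    have hkj : B j k < 0 ∧ 0 < B k j := by have := dich j hjk; omega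
    by_cases hp : 0 < B i k
    · rw [mutB_pp hik hjk hp hkj.2]
      have := (hB.grow hk i j hp hkj.2).1; omega
    have hGi := hi.resolve_left hp
    have hki : B i k < 0 ∧ 0 < B k i := by have := dich i hik; omega
    rw [mutB_np hik hjk hki.1 hkj.2]
    have hij : i ≠ j := by rintro rfl; exact hj2 hGi
    by_cases hir : i = r
    · subst hir
      have := h.c3a k hk hG hGi
      omega
    by_cases hjr : j = r
    · subst hjr
      by_contra hcon
      have h3 : 0 < B j i := by have := hB.ab i j hij; have := sk i j; omega
      have := hB.fk k i hkj.2 h3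
      omega
    exact h.c4 i j hir hjr hGi hj2

/-- The invariant. -/
def ForkInv (P : Matrix V V ℤ × Matrix V W ℤ) (r : V) : Prop :=
  QF P.1 r ∧ ∃ G, SC P.1 P.2 r G

theorem ForkInv.neg {P : Matrix V V ℤ × Matrix V W ℤ} {r : V} (h : ForkInv P r) :
    ForkInv (-P.1, -P.2) r := by
  obtain ⟨h1, G, h2⟩ := h
  exact ⟨h1.neg, _, h2.neg h1⟩

theorem ForkInv.step {P : Matrix V V ℤ × Matrix V W ℤ} {r k : V} (h : ForkInv P r) (hk : k ≠ r) :
    ForkInv (mutPair P k) k := by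
  obtain ⟨h1, G, h2⟩ := h
  by_cases hG : G k
  · exact ⟨h1.step hk, _, h2.step_green h1 hk hG⟩
  · have h3 : ForkInv (mutB (-P.1) k, mutC (-P.1) (-P.2) k) k :=
      ⟨h1.neg.step hk, _, (h2.neg h1).step_green h1.neg hk hG⟩
    have := h3.neg
    rw [mutB_neg, mutC_neg] at this
    simpa [mutPair] using this

theorem ForkInv.color {P : Matrix V V ℤ × Matrix V W ℤ} {r : V} (h : ForkInv P r) (i : V) :
    QRed P.2 i ∨ QGreen P.2 i := by
  obtain ⟨-, G, h2⟩ := h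
  obtain ⟨t, ht⟩ := h2.nz i
  have hne : P.2 i ≠ 0 := fun h => ht (by rw [h]; rfl)
  by_cases hG : G i
  · exact Or.inr ⟨h2.gp i hG, hne⟩
  · exact Or.inl ⟨h2.gn i hG, hne⟩

/-- The first mutation, starting from an all green transitive abundant quiver. -/
theorem ForkInv.first {B : Matrix V V ℤ} {C : Matrix V W ℤ} (h : SkAb B)
    (tr : ∀ i j k, 0 < B i j → 0 < B j k → 0 < B i k)
    (hC : ∀ i t, 0 ≤ C i t) (nz : ∀ i, ∃ t, C i t ≠ 0) (k : V) : ForkInv (mutPair (B, C) k) k := by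
  have sk := h.sk
  have kk : B k k = 0 := by have := sk k k; omega
  have dich : ∀ i, i ≠ k → 2 ≤ B i k ∨ B i k < 0 := by
    intro i hi
    have := h.ab i k hi; omega
  have hge : ∀ i, i ≠ k → ∀ t, C i t ≤ mutC B C k i t := by
    intro i hik t
    rcases dich i hik with a | a
    · rw [mutC_p hik (by omega) (hC k t)]
      have := hC k t; nlinarith
    · rw [mutC_n hik a (hC k t)]
  refine ⟨QF_of_local h ?_ (fun i j l _ _ _ => tr i j l) (fun i j l _ _ _ => tr i j l),
    fun i => i ≠ k, ?_⟩
  · intro i j hi hj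
    have := tr i k j hi hj
    constructor <;> nlinarith
  simp only [mutPair]
  constructor
  · intro i hi t
    exact (hC i t).trans (hge i hi t)
  · intro i hi t
    obtain rfl := not_not.1 hi
    rw [mutC_self]; have := hC i t; omega
  · intro i
    obtain ⟨t, ht⟩ := nz i
    refine ⟨t, ?_⟩
    by_cases hik : i = k
    · subst hik; rw [mutC_self]; omega
    · have := hge i hik t; have := hC i t; omega
  · intro j hj _ hb t
    rw [mutB_of_left] at hb
    have hjk : 0 < B j k := by have := sk k j; omega
    rw [mutC_self, mutC_p hj hjk (hC k t)]
    have := hC k t; have := hC j t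
    nlinarith
  · intro j _ h2; exact absurd rfl h2
  · intro j _ _ h2; exact absurd rfl h2
  · intro j hj h1; exact absurd hj h1
  · intro i j hi hj _ h2; exact absurd hj h2

/-- States reachable by reduced mutation sequences. -/
inductive Reach (P : Matrix V V ℤ × Matrix V W ℤ) : Matrix V V ℤ × Matrix V W ℤ → Option V → Prop
  | base : Reach P P none
  | step (Q : Matrix V V ℤ × Matrix V W ℤ) (o : Option V) (k : V) (h : Reach P Q o)
      (hk : o ≠ some k) : Reach P (mutPair Q k) (some k)

theorem reach_all (P : Matrix V V ℤ × Matrix V W ℤ) (w : List V) :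
    ∃ o, Reach P (mutSeqPair P w) o := by
  induction w using List.reverseRecOn with
  | nil => exact ⟨none, Reach.base⟩
  | append_singleton w k ih =>
    obtain ⟨o, ho⟩ := ih
    have e : mutSeqPair P (w ++ [k]) = mutPair (mutSeqPair P w) k := by simp [mutSeqPair]
    rw [e]
    by_cases hok : o = some k
    · subst hok
      generalize mutSeqPair P w = Q at ho
      cases ho with
      | step Q o _ h hk => rw [mutPair_invol]; exact ⟨o, h⟩
    · exact ⟨_, Reach.step _ _ _ ho hok⟩

theorem ssc_of_first {P : Matrix V V ℤ × Matrix V W ℤ} (h0 : ∀ i, QRed P.2 i ∨ QGreen P.2 i)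
    (h1 : ∀ k, ForkInv (mutPair P k) k) : SSC P := by
  have key : ∀ Q o, Reach P Q o → (o = none ∧ Q = P) ∨ ∃ r, o = some r ∧ ForkInv Q r := by
    intro Q o h
    induction h with
    | base => exact Or.inl ⟨rfl, rfl⟩
    | step Q o k h hk ih =>
      right
      rcases ih with ⟨-, rfl⟩ | ⟨r, rfl, hr⟩
      · exact ⟨k, rfl, h1 k⟩
      · exact ⟨k, rfl, hr.step (by rintro rfl; exact hk rfl)⟩
  intro w i
  obtain ⟨o, ho⟩ := reach_all P w
  rcases key _ _ ho with ⟨-, e⟩ | ⟨r, -, hr⟩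
  · rw [e]; exact h0 i
  · exact hr.color i

end Helpers

/-- Corollary `cor-sign-coherence-abundant acyclic` (framing and coframing of an
abundant acyclic quiver are strictly sign-coherent). -/
theorem framing_coframing_abundant_acyclic_ssc {n : ℕ}
    (B : Matrix (Fin n) (Fin n) ℤ)
    (hskew : ∀ i j, B j i = -B i j)
    (habund : QAbundant B) (hacyc : QAcyclic B) :
    SSC (B, (1 : Matrix (Fin n) (Fin n) ℤ)) ∧
    SSC (B, (-1 : Matrix (Fin n) (Fin n) ℤ)) := by
  have sk : SkAb B := ⟨hskew, fun i j hij => by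
    have := habund i j hij
    rcases le_abs.1 this with h | h <;> omega⟩
  have dd : ∀ i, B i i = 0 := fun i => by have := hskew i i; omega
  have tr : ∀ i j k, 0 < B i j → 0 < B j k → 0 < B i k := by
    intro i j k h1 h2
    by_contra hcon
    have hik : i ≠ k := by rintro rfl; have := hskew i j; omega
    have h3 : 0 < B k i := by have := sk.ab i k hik; have := hskew i k; omega
    refine hacyc ⟨i, [j, k], trivial, fun _ _ => trivial, ?_⟩
    simp [List.Chain, h1, h2, h3]
  have hne : ∀ i, ((1 : Matrix (Fin n) (Fin n) ℤ) i) ≠ 0 := fun i h => by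
    have := congrFun h i; simp at this
  have hnn : ∀ i t, 0 ≤ (1 : Matrix (Fin n) (Fin n) ℤ) i t := fun i t => by
    rw [Matrix.one_apply]; split_ifs <;> simp
  have hnz : ∀ i, ∃ t, (1 : Matrix (Fin n) (Fin n) ℤ) i t ≠ 0 := fun i => ⟨i, by simp⟩
  constructor
  · exact ssc_of_first (fun i => Or.inr ⟨hnn i, hne i⟩) (ForkInv.first sk tr hnn hnz)
  · refine ssc_of_first (fun i => Or.inl ⟨fun t => ?_, fun h => hne i ?_⟩) (fun k => ?_)
    · have := hnn i t
      simp only [Matrix.neg_apply]; omega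
    · have h' : -((1 : Matrix (Fin n) (Fin n) ℤ) i) = 0 := h
      exact neg_eq_zero.1 h'
    · have sk' : SkAb (-B) := ⟨fun i j => by simp [hskew i j], fun i j hij => by
        have := sk.ab i j hij; simp only [Matrix.neg_apply]; omega⟩
      have tr' : ∀ i j k, 0 < (-B) i j → 0 < (-B) j k → 0 < (-B) i k := by
        intro i j k h1 h2
        simp only [Matrix.neg_apply] at *
        have := tr k j i (by rw [hskew j k]; exact h2) (by rw [hskew i j]; exact h1)
        rw [hskew i k] at this; exact this
      have := (ForkInv.first sk' tr' hnn hnz k).neg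
      have e : mutC (-B) (1 : Matrix (Fin n) (Fin n) ℤ) k = -mutC B (-1) k := by
        rw [← mutC_neg, neg_neg]
      simp only [mutPair, mutB_neg, e, neg_neg] at this
      exact this
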